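/- Let m > 0, d > 0 and c ∈ ℝ with c + d > 0, and define q^∞ : (0,1) → ℝ by q^∞(u) := (1/m)·(−(c+d)·log(2−2u) + d·log(2u)). Then q^∞ is continuously differentiable and strictly increasing on (0,1), and the pushforward λ^∞ of the Lebesgue measure restricted to (0,1) under q^∞ is a Borel probability measure on ℝ that is absolutely continuous with respect to Lebesgue measure on ℝ. -/

import Mathlib

open MeasureTheory

/-- The pushforward of Lebesgue measure on `s` under a map that is injective on `s` with nowhere
vanishing derivative is absolutely continuous. -/
theorem absolutelyContinuous_map_restrict_of_hasDerivWithinAt {f f' : ℝ → ℝ} {s : Set ℝ}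
    (hs : MeasurableSet s) (hf : Measurable f)
    (hf' : ∀ x ∈ s, HasDerivWithinAt f (f' x) s x) (hinj : Set.InjOn f s)
    (hne : ∀ x ∈ s, f' x ≠ 0) :
    (volume.restrict s).map f ≪ volume := by
  refine Measure.AbsolutelyContinuous.mk fun A hA hA0 => ?_
  rw [Measure.map_apply hf hA, Measure.restrict_apply (hf hA)]
  have ht : MeasurableSet (f ⁻¹' A ∩ s) := (hf hA).inter hs
  have himage : volume (f '' (f ⁻¹' A ∩ s)) = 0 :=
    measure_mono_null (by rintro _ ⟨x, hx, rfl⟩; exact hx.1) hA0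
  have hint := lintegral_image_eq_lintegral_abs_deriv_mul ht
    (fun x hx => (hf' x hx.2).mono Set.inter_subset_right)
    (hinj.mono Set.inter_subset_right) (fun _ => 1)
  rw [setLIntegral_one, himage] at hint
  have hmeas : AEMeasurable (fun x => ENNReal.ofReal |f' x| * 1)
      (volume.restrict (f ⁻¹' A ∩ s)) := by
    simpa using aemeasurable_ofReal_abs_det_fderivWithin volume ht
      (fun x hx => ((hf' x hx.2).mono Set.inter_subset_right).hasFDerivWithinAt)
  have hzero := (lintegral_eq_zero_iff' hmeas).1 hint.symm
  have hfalse : ∀ᵐ x ∂volume.restrict (f ⁻¹' A ∩ s), False := by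
    filter_upwards [hzero, ae_restrict_mem ht] with x hx hxt
    have hpos := abs_pos.2 (hne x hxt.2)
    have hle : |f' x| ≤ 0 := by simpa only [mul_one, Pi.zero_apply, ENNReal.ofReal_eq_zero] using hx
    exact hpos.not_ge hle
  simpa using hfalse

/-- The quantile function is differentiable on `(0,1)`. -/
theorem hasDerivAt_logQuantile (m d c : ℝ) {u : ℝ} (hu : u ∈ Set.Ioo (0 : ℝ) 1) :
    HasDerivAt
      (fun u : ℝ => (1 / m) * (-(c + d) * Real.log (2 - 2 * u) + d * Real.log (2 * u)))
      ((1 / m) * ((c + d) / (1 - u) + d / u)) u := by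
  obtain ⟨h0, h1⟩ := hu
  have h2 : 2 - 2 * u ≠ 0 := (by linarith : 0 < 2 - 2 * u).ne'
  have h3 : 2 * u ≠ 0 := (by linarith : 0 < 2 * u).ne'
  have h4 : 1 - u ≠ 0 := (by linarith : 0 < 1 - u).ne'
  have hlin : HasDerivAt (fun u : ℝ => 2 * u) 2 u := by
    simpa using (hasDerivAt_id u).const_mul (2 : ℝ)
  refine (((((hlin.const_sub 2).log h2).const_mul (-(c + d))).add
    ((hlin.log h3).const_mul d)).const_mul (1 / m)).congr_deriv ?_
  have h5 : 2 - 2 * u = 2 * (1 - u) := by ring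
  rw [h5]
  field_simp

/-- Let `m > 0`, `d > 0`, `c ∈ ℝ` with `c + d > 0`, and
`q^∞(u) := (1/m)·(−(c+d)·log(2−2u) + d·log(2u))`. Then `q^∞` is continuously
differentiable and strictly increasing on `(0,1)`, and the pushforward of the Lebesgue
measure restricted to `(0,1)` under `q^∞` is a Borel probability measure on `ℝ` that is
absolutely continuous with respect to Lebesgue measure. -/
theorem stmt_18 (m d c : ℝ) (hm : 0 < m) (hd : 0 < d) (hcd : 0 < c + d) :
    ContDiffOn ℝ 1
        (fun u : ℝ => (1 / m) * (-(c + d) * Real.log (2 - 2 * u) + d * Real.log (2 * u)))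
        (Set.Ioo 0 1)
    ∧ StrictMonoOn
        (fun u : ℝ => (1 / m) * (-(c + d) * Real.log (2 - 2 * u) + d * Real.log (2 * u)))
        (Set.Ioo 0 1)
    ∧ IsProbabilityMeasure
        ((volume.restrict (Set.Ioo (0 : ℝ) 1)).map
          (fun u : ℝ => (1 / m) * (-(c + d) * Real.log (2 - 2 * u) + d * Real.log (2 * u))))
    ∧ ((volume.restrict (Set.Ioo (0 : ℝ) 1)).map
          (fun u : ℝ => (1 / m) * (-(c + d) * Real.log (2 - 2 * u) + d * Real.log (2 * u))))
        ≪ volume := by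
  have hmeas : Measurable
      (fun u : ℝ => (1 / m) * (-(c + d) * Real.log (2 - 2 * u) + d * Real.log (2 * u))) := by
    fun_prop
  have hderiv := fun (u : ℝ) (hu : u ∈ Set.Ioo (0 : ℝ) 1) => hasDerivAt_logQuantile m d c hu
  have hpos : ∀ u ∈ Set.Ioo (0 : ℝ) 1, 0 < (1 / m) * ((c + d) / (1 - u) + d / u) := by
    rintro u ⟨h0, h1⟩
    have : 0 < 1 - u := by linarith
    positivity
  have hmono : StrictMonoOn
      (fun u : ℝ => (1 / m) * (-(c + d) * Real.log (2 - 2 * u) + d * Real.log (2 * u)))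
      (Set.Ioo 0 1) := by
    refine strictMonoOn_of_deriv_pos (convex_Ioo 0 1)
      (fun u hu => (hderiv u hu).continuousAt.continuousWithinAt) fun u hu => ?_
    rw [interior_Ioo] at hu
    rw [(hderiv u hu).deriv]
    exact hpos u hu
  refine ⟨?_, hmono, ?_, ?_⟩
  · refine contDiffOn_const.mul ((contDiffOn_const.mul (ContDiffOn.log (by fun_prop) ?_)).add
      (contDiffOn_const.mul (ContDiffOn.log (by fun_prop) ?_)))
    · rintro u ⟨h0, h1⟩
      exact (by linarith : 0 < 2 - 2 * u).ne'
    · rintro u ⟨h0, h1⟩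
      exact (by linarith : 0 < 2 * u).ne'
  · have : IsProbabilityMeasure (volume.restrict (Set.Ioo (0 : ℝ) 1)) := ⟨by simp⟩
    exact Measure.isProbabilityMeasure_map hmeas.aemeasurable
  · exact absolutelyContinuous_map_restrict_of_hasDerivWithinAt measurableSet_Ioo hmeas
      (fun u hu => (hderiv u hu).hasDerivWithinAt) hmono.injOn fun u hu => (hpos u hu).ne'
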